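/- Let q be an odd prime power with q ≡ 3 (mod 4), q > 3, and set d = (q-3)/2. Let λ = ∑_{x∈F_q} χ(x(x²+4x-1)) + ∑_{x∈F_q} χ(x(x²-2x+5)). If 5 is a nonzero square in F_q, then the number of quadruples (x₁,x₂,x₃,x₄) ∈ F_q⁴ with x₁ - x₂ + x₃ - x₄ = 0 and x₁^d - x₂^d + x₃^d - x₄^d = 0 equals (5q² + (λ+6)q - (λ+9))/2. -/

import Mathlib

open Finset

section FiniteField

variable {F : Type*} [Field F] [Fintype F]

theorem ringChar_ne_two_of_card_mod_four (hq3 : Fintype.card F % 4 = 3) : ringChar F ≠ 2 := by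
  intro h
  have := FiniteField.even_card_iff_char_two.mp h
  omega

theorem two_ne_zero_of_card_mod_four (hq3 : Fintype.card F % 4 = 3) : (2 : F) ≠ 0 :=
  Ring.two_ne_zero (ringChar_ne_two_of_card_mod_four hq3)

theorem sum_eq_zero_of_odd (f : F → ℤ) (hf : ∀ x, f (-x) = -f x) : ∑ x, f x = 0 := by
  have h := Equiv.sum_comp (Equiv.neg F) f
  simp only [Equiv.neg_apply, hf, Finset.sum_neg_distrib] at h
  omega

theorem sq_add_one_ne_zero_of_card_mod_four (hq3 : Fintype.card F % 4 = 3) (s : F) :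
    s ^ 2 + 1 ≠ 0 := by
  intro h
  have : IsSquare (-1 : F) := ⟨s, by linear_combination -h⟩
  rw [FiniteField.isSquare_neg_one_iff] at this
  exact this hq3

end FiniteField

section PairSum

variable {F : Type*} [Field F]

/-- The sum of `d`-th powers over the pair `x, 1 - x`. -/
def pairSum (d : ℕ) (x : F) : F := x ^ d + (1 - x) ^ d

theorem pairSum_one_sub (d : ℕ) (x : F) : pairSum d (1 - x) = pairSum d x := by
  simp only [pairSum, sub_sub_cancel]
  ring

theorem pairSum_zero {d : ℕ} (hd0 : d ≠ 0) : pairSum d (0 : F) = 1 := by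
  simp [pairSum, hd0]

theorem pairSum_one {d : ℕ} (hd0 : d ≠ 0) : pairSum d (1 : F) = 1 := by
  simp [pairSum, hd0]

end PairSum

section CharacterSums

variable {F : Type*} [Field F] [Fintype F] [DecidableEq F]

theorem quadraticChar_neg_of_card_mod_four (hq3 : Fintype.card F % 4 = 3) (x : F) :
    quadraticChar F (-x) = -quadraticChar F x := by
  have h : quadraticChar F (-1) = -1 := by
    rw [quadraticChar_neg_one_iff_not_isSquare, FiniteField.isSquare_neg_one_iff]
    omega
  rw [neg_eq_neg_one_mul, map_mul, h, neg_one_mul]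

theorem sum_comp_sq (hF : ringChar F ≠ 2) (h : F → ℤ) :
    ∑ t, h (t ^ 2) = ∑ u, (1 + quadraticChar F u) * h u := by
  rw [← Finset.sum_fiberwise (s := univ) (g := fun t : F => t ^ 2)]
  refine Finset.sum_congr rfl fun u _ => ?_
  rw [Finset.sum_congr rfl (g := fun _ => h u) (fun t ht => by rw [(mem_filter.mp ht).2]),
    sum_const, nsmul_eq_mul, add_comm, ← quadraticChar_card_sqrts hF u]
  congr 3
  ext t
  simp

theorem card_quadratic (hF : ringChar F ≠ 2) (b c : F) :
    ((univ.filter fun x : F => x ^ 2 - b * x + c = 0).card : ℤ) =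
      1 + quadraticChar F (b ^ 2 - 4 * c) := by
  have h2 : (2 : F) ≠ 0 := Ring.two_ne_zero hF
  rw [add_comm, ← quadraticChar_card_sqrts hF]
  congr 1
  refine Finset.card_nbij' (fun x => 2 * x - b) (fun y => (y + b) / 2) ?_ ?_ ?_ ?_
  · intro x hx
    simp only [coe_filter, mem_univ, true_and, Set.mem_ofPred_eq, Set.coe_toFinset] at hx ⊢
    linear_combination 4 * hx
  · intro y hy
    simp only [coe_filter, mem_univ, true_and, Set.mem_ofPred_eq, Set.coe_toFinset] at hy ⊢
    field_simp
    linear_combination hy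
  · intro x _
    simp only
    field_simp
    ring
  · intro y _
    simp only
    field_simp
    ring

theorem sum_comp_add_div (hF : ringChar F ≠ 2) {b : F} (hb : b ≠ 0) (h : F → ℤ) :
    ∑ x ∈ univ.filter (fun x : F => x ≠ 0), h (x + b / x) =
      ∑ u, (1 + quadraticChar F (u ^ 2 - 4 * b)) * h u := by
  rw [← Finset.sum_fiberwise (g := fun x : F => x + b / x)]
  refine Finset.sum_congr rfl fun u _ => ?_
  rw [Finset.sum_congr rfl (g := fun _ => h u) (fun t ht => by rw [(mem_filter.mp ht).2]),
    sum_const, nsmul_eq_mul, ← card_quadratic hF]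
  congr 3
  ext x
  simp only [mem_filter, mem_univ, true_and]
  constructor
  · rintro ⟨hx, rfl⟩
    field_simp
    ring
  · intro hx
    have hx0 : x ≠ 0 := by
      rintro rfl
      apply hb
      linear_combination hx
    refine ⟨hx0, ?_⟩
    field_simp
    linear_combination hx

theorem sum_quadraticChar_sq_sub (hF : ringChar F ≠ 2) {b : F} (hb : b ≠ 0) :
    ∑ u : F, quadraticChar F (u ^ 2 - 4 * b) = -1 := by
  have h := sum_comp_add_div hF hb (fun _ => 1)
  simp only [mul_one, sum_add_distrib, sum_const, nsmul_eq_mul] at h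
  rw [filter_ne' univ (0 : F), card_erase_of_mem (mem_univ _), card_univ,
    Nat.cast_sub Fintype.card_pos] at h
  push_cast at h
  linarith

theorem quadraticChar_mul_sq (x : F) {y : F} (hy : y ≠ 0) :
    quadraticChar F (x * y ^ 2) = quadraticChar F x := by
  rw [map_mul, quadraticChar_sq_one' hy, mul_one]

/-- Two-isogenous curves `y² = x (x² + a x + b)` and `y² = x (x² - 2 a x + a² - 4 b)` have equal
character sums. -/
theorem sum_quadraticChar_isogeny (hF : ringChar F ≠ 2) (a : F) {b : F} (hb : b ≠ 0) :
    ∑ x : F, quadraticChar F (x * (x ^ 2 + a * x + b)) =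
      ∑ x : F, quadraticChar F (x * (x ^ 2 - 2 * a * x + (a ^ 2 - 4 * b))) := by
  have h := sum_comp_add_div hF hb (fun u => quadraticChar F (u + a))
  have hl : ∑ x ∈ univ.filter (fun x : F => x ≠ 0), quadraticChar F (x + b / x + a) =
      ∑ x : F, quadraticChar F (x * (x ^ 2 + a * x + b)) := by
    rw [sum_filter]
    refine sum_congr rfl fun x _ => ?_
    split_ifs with hx
    · rw [← quadraticChar_mul_sq _ hx]
      congr 1
      field_simp
      ring
    · rw [not_not] at hx
      simp [hx]
  rw [← hl, h]
  simp only [add_mul, one_mul, sum_add_distrib, ← map_mul]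
  have h0 : ∑ u : F, quadraticChar F (u + a) = 0 := by
    rw [← quadraticChar_sum_zero hF]
    exact Equiv.sum_comp (Equiv.addRight a) (fun x => quadraticChar F x)
  rw [h0, zero_add, ← Equiv.sum_comp (Equiv.subRight a)]
  refine sum_congr rfl fun x _ => ?_
  congr 1
  simp only [Equiv.subRight_apply]
  ring

end CharacterSums

section MixedWeight

variable {F : Type*} [Field F] [Fintype F] [DecidableEq F]

theorem sum_quadraticChar_two_mul_cubic (hF : ringChar F ≠ 2) (h5 : (5 : F) ≠ 0) :
    ∑ s : F, quadraticChar F (2 * s * (s ^ 2 - 4 * s + 5)) =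
      ∑ x : F, quadraticChar F (x * (x ^ 2 + 4 * x - 1)) := by
  have h2 : (2 : F) ≠ 0 := Ring.two_ne_zero hF
  have h := sum_quadraticChar_isogeny hF (-4) h5
  have hl (s : F) : quadraticChar F (2 * s * (s ^ 2 - 4 * s + 5)) =
      quadraticChar F 2 * quadraticChar F (s * (s ^ 2 + -4 * s + 5)) := by
    rw [← map_mul]
    congr 1
    ring
  simp only [hl]
  rw [← mul_sum, h, mul_sum, ← Equiv.sum_comp (Equiv.mulLeft₀ (2 : F) h2)]
  refine sum_congr rfl fun x _ => ?_
  rw [← map_mul, ← quadraticChar_mul_sq (x * (x ^ 2 + 4 * x - 1)) (pow_ne_zero 2 h2)]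
  congr 1
  simp only [Equiv.mulLeft₀_apply]
  ring

theorem sum_quadraticChar_one_sub_sq (hq3 : Fintype.card F % 4 = 3) :
    ∑ t : F, quadraticChar F ((1 + t) * (1 - t)) = 1 := by
  have hF := ringChar_ne_two_of_card_mod_four hq3
  have h2 : (2 : F) ≠ 0 := Ring.two_ne_zero hF
  have h := sum_quadraticChar_sq_sub hF (b := (1 / 4 : F))
    (one_div_ne_zero (by rw [show (4 : F) = 2 * 2 by norm_num]; exact mul_ne_zero h2 h2))
  have hl (t : F) : quadraticChar F ((1 + t) * (1 - t)) =
      -quadraticChar F (t ^ 2 - 4 * (1 / 4)) := by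
    have h4 : (4 : F) ≠ 0 := by
      rw [show (4 : F) = 2 * 2 by norm_num]; exact mul_ne_zero h2 h2
    rw [← quadraticChar_neg_of_card_mod_four hq3]
    congr 1
    field_simp
    ring
  simp only [hl, sum_neg_distrib, h, neg_neg]

theorem sum_quadraticChar_quartic (hq3 : Fintype.card F % 4 = 3) :
    ∑ t : F, quadraticChar F ((t ^ 2 + 2 * t + 2) * (t ^ 2 - 2 * t + 2)) = -1 := by
  have hF := ringChar_ne_two_of_card_mod_four hq3
  have hl (t : F) : quadraticChar F ((t ^ 2 + 2 * t + 2) * (t ^ 2 - 2 * t + 2)) =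
      quadraticChar F ((t ^ 2) ^ 2 - 4 * -1) := by
    congr 1
    ring
  simp only [hl]
  rw [sum_comp_sq hF (fun u => quadraticChar F (u ^ 2 - 4 * -1))]
  simp only [add_mul, one_mul, sum_add_distrib]
  rw [sum_quadraticChar_sq_sub hF (neg_ne_zero.mpr one_ne_zero), sum_eq_zero_of_odd, add_zero]
  intro x
  rw [quadraticChar_neg_of_card_mod_four hq3, neg_sq, neg_mul]

theorem sum_quadraticChar_sextic (hq3 : Fintype.card F % 4 = 3) :
    ∑ t : F, quadraticChar F
        ((1 + t) * (1 - t) * ((t ^ 2 + 2 * t + 2) * (t ^ 2 - 2 * t + 2))) =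
      ∑ x : F, quadraticChar F (x * (x ^ 2 - 2 * x + 5)) -
        ∑ s : F, quadraticChar F (2 * s * (s ^ 2 - 4 * s + 5)) + 1 := by
  have hF := ringChar_ne_two_of_card_mod_four hq3
  have h2 : (2 : F) ≠ 0 := Ring.two_ne_zero hF
  have hl (t : F) : quadraticChar F
        ((1 + t) * (1 - t) * ((t ^ 2 + 2 * t + 2) * (t ^ 2 - 2 * t + 2))) =
      quadraticChar F ((1 - t ^ 2) * ((t ^ 2) ^ 2 + 4)) := by
    congr 1
    ring
  simp only [hl]
  rw [sum_comp_sq hF (fun u => quadraticChar F ((1 - u) * (u ^ 2 + 4)))]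
  simp only [add_mul, one_mul, sum_add_distrib]
  have e1 : ∑ u : F, quadraticChar F ((1 - u) * (u ^ 2 + 4)) =
      ∑ x : F, quadraticChar F (x * (x ^ 2 - 2 * x + 5)) := by
    rw [← Equiv.sum_comp (Equiv.subLeft (1 : F))]
    refine sum_congr rfl fun x _ => ?_
    congr 1
    simp only [Equiv.subLeft_apply]
    ring
  have e2 : ∑ u : F, quadraticChar F u * quadraticChar F ((1 - u) * (u ^ 2 + 4)) =
      ∑ y : F, if y = 0 then 0 else quadraticChar F ((y - 1) * (4 * y ^ 2 + 1)) := by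
    rw [← Equiv.sum_comp (Equiv.inv F)]
    refine sum_congr rfl fun y _ => ?_
    simp only [Equiv.inv_apply]
    split_ifs with hy
    · simp [hy]
    · rw [← map_mul, ← quadraticChar_mul_sq _ (pow_ne_zero 2 hy)]
      congr 1
      field_simp
      ring
  have e3 : ∑ y : F, quadraticChar F ((y - 1) * (4 * y ^ 2 + 1)) =
      -∑ s : F, quadraticChar F (2 * s * (s ^ 2 - 4 * s + 5)) := by
    rw [← sum_neg_distrib, ← Equiv.sum_comp
      (((Equiv.neg F).trans (Equiv.mulRight₀ (2 : F)⁻¹ (inv_ne_zero h2))).trans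
        (Equiv.addRight 1))]
    refine sum_congr rfl fun s _ => ?_
    rw [← quadraticChar_neg_of_card_mod_four hq3, ← quadraticChar_mul_sq _ h2]
    congr 1
    simp only [Equiv.trans_apply, Equiv.neg_apply, Equiv.mulRight₀_apply, Equiv.coe_addRight]
    field_simp
    ring
  have e4 : ∑ y : F, (if y = 0 then 0 else quadraticChar F ((y - 1) * (4 * y ^ 2 + 1))) =
      ∑ y : F, quadraticChar F ((y - 1) * (4 * y ^ 2 + 1)) + 1 := by
    rw [← sum_erase_add univ _ (mem_univ (0 : F)), ← sum_erase_add univ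
      (fun y : F => quadraticChar F ((y - 1) * (4 * y ^ 2 + 1))) (mem_univ (0 : F))]
    have : quadraticChar F ((0 - 1) * (4 * 0 ^ 2 + 1)) = -1 := by
      rw [show ((0 : F) - 1) * (4 * 0 ^ 2 + 1) = -1 by ring,
        quadraticChar_neg_of_card_mod_four hq3, map_one]
    simp only [this, if_true]
    rw [sum_congr rfl fun y hy => if_neg (ne_of_mem_erase hy)]
    ring
  rw [e1, e2, e4, e3]
  ring

/-- The weight with which a value `t = 2 √(x (1 - x))` enters the count of mixed solutions. -/
def mixedWeight (t : F) : ℤ :=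
  (1 + quadraticChar F (1 + t) * quadraticChar F (1 - t)) *
      (1 + quadraticChar F (t ^ 2 + 2 * t + 2) * quadraticChar F (t ^ 2 - 2 * t + 2)) +
    quadraticChar F 2 * (quadraticChar F (1 + t) + quadraticChar F (1 - t)) *
      (quadraticChar F (t ^ 2 + 2 * t + 2) + quadraticChar F (t ^ 2 - 2 * t + 2))

theorem sum_mixedWeight (hq3 : Fintype.card F % 4 = 3) (h5 : (5 : F) ≠ 0) :
    ∑ t : F, mixedWeight t = Fintype.card F + 1 +
      (∑ x : F, quadraticChar F (x * (x ^ 2 + 4 * x - 1)) +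
        ∑ x : F, quadraticChar F (x * (x ^ 2 - 2 * x + 5))) := by
  have hF := ringChar_ne_two_of_card_mod_four hq3
  have expand (t : F) : mixedWeight t = 1 + quadraticChar F ((1 + t) * (1 - t)) +
      quadraticChar F ((t ^ 2 + 2 * t + 2) * (t ^ 2 - 2 * t + 2)) +
      quadraticChar F ((1 + t) * (1 - t) * ((t ^ 2 + 2 * t + 2) * (t ^ 2 - 2 * t + 2))) +
      quadraticChar F (2 * (1 + t) * (t ^ 2 + 2 * t + 2)) +
      quadraticChar F (2 * (1 - t) * (t ^ 2 + 2 * t + 2)) +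
      quadraticChar F (2 * (1 + t) * (t ^ 2 - 2 * t + 2)) +
      quadraticChar F (2 * (1 - t) * (t ^ 2 - 2 * t + 2)) := by
    simp only [mixedWeight, map_mul]
    ring
  have odd : ∑ s : F, quadraticChar F (2 * s * (s ^ 2 + 1)) = 0 := by
    refine sum_eq_zero_of_odd _ fun s => ?_
    rw [← quadraticChar_neg_of_card_mod_four hq3]
    congr 1
    ring
  have f1 : ∑ t : F, quadraticChar F (2 * (1 + t) * (t ^ 2 + 2 * t + 2)) = 0 := by
    rw [← odd, ← Equiv.sum_comp (Equiv.subRight (1 : F))]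
    refine sum_congr rfl fun t _ => ?_
    congr 1
    simp only [Equiv.subRight_apply]
    ring
  have f2 : ∑ t : F, quadraticChar F (2 * (1 - t) * (t ^ 2 - 2 * t + 2)) = 0 := by
    rw [← odd, ← Equiv.sum_comp (Equiv.subLeft (1 : F))]
    refine sum_congr rfl fun t _ => ?_
    congr 1
    simp only [Equiv.subLeft_apply]
    ring
  have f3 : ∑ t : F, quadraticChar F (2 * (1 - t) * (t ^ 2 + 2 * t + 2)) =
      ∑ s : F, quadraticChar F (2 * s * (s ^ 2 - 4 * s + 5)) := by
    rw [← Equiv.sum_comp (Equiv.subLeft (1 : F))]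
    refine sum_congr rfl fun t _ => ?_
    congr 1
    simp only [Equiv.subLeft_apply]
    ring
  have f4 : ∑ t : F, quadraticChar F (2 * (1 + t) * (t ^ 2 - 2 * t + 2)) =
      ∑ s : F, quadraticChar F (2 * s * (s ^ 2 - 4 * s + 5)) := by
    rw [← Equiv.sum_comp (Equiv.subRight (1 : F))]
    refine sum_congr rfl fun t _ => ?_
    congr 1
    simp only [Equiv.subRight_apply]
    ring
  simp only [expand, sum_add_distrib]
  rw [f1, f2, f3, f4, sum_quadraticChar_one_sub_sq hq3, sum_quadraticChar_quartic hq3,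
    sum_quadraticChar_sextic hq3, sum_quadraticChar_two_mul_cubic hF h5]
  simp only [sum_const, card_univ, nsmul_eq_mul, mul_one]
  ring

end MixedWeight

section Collisions

variable {F : Type*} [Field F] [Fintype F] [DecidableEq F]

theorem pow_mul_self_eq_quadraticChar (hq3 : Fintype.card F % 4 = 3) {d : ℕ}
    (hd : d = (Fintype.card F - 3) / 2) (x : F) : x ^ d * x = (quadraticChar F x : F) := by
  rw [quadraticChar_eq_pow_of_char_ne_two' (ringChar_ne_two_of_card_mod_four hq3), ← pow_succ]
  congr 1
  omega

theorem pairSum_mul (hq3 : Fintype.card F % 4 = 3) {d : ℕ}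
    (hd : d = (Fintype.card F - 3) / 2) (x : F) :
    pairSum d x * (x * (1 - x)) =
      (quadraticChar F x : F) * (1 - x) + (quadraticChar F (1 - x) : F) * x := by
  rw [← pow_mul_self_eq_quadraticChar hq3 hd x, ← pow_mul_self_eq_quadraticChar hq3 hd (1 - x),
    pairSum]
  ring

/-- The points where `x` and `1 - x` are nonzero of the same quadratic character. -/
def alike (F : Type*) [Field F] [Fintype F] [DecidableEq F] : Finset F :=
  univ.filter fun x => quadraticChar F x * quadraticChar F (1 - x) = 1

/-- The points where `x` and `1 - x` are nonzero of opposite quadratic character. -/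
def unlike (F : Type*) [Field F] [Fintype F] [DecidableEq F] : Finset F :=
  univ.filter fun x => quadraticChar F x * quadraticChar F (1 - x) = -1

theorem mem_alike {x : F} :
    x ∈ alike F ↔ x ≠ 0 ∧ 1 - x ≠ 0 ∧ quadraticChar F (1 - x) = quadraticChar F x := by
  simp only [alike, mem_filter, mem_univ, true_and]
  by_cases hx : x = 0
  · simp [hx]
  by_cases hx' : 1 - x = 0
  · simp [hx']
  rcases quadraticChar_dichotomy hx with h | h <;>
    rcases quadraticChar_dichotomy hx' with h' | h' <;> simp [h, h', hx, hx']

theorem mem_unlike {x : F} :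
    x ∈ unlike F ↔ x ≠ 0 ∧ 1 - x ≠ 0 ∧ quadraticChar F (1 - x) = -quadraticChar F x := by
  simp only [unlike, mem_filter, mem_univ, true_and]
  by_cases hx : x = 0
  · simp [hx]
  by_cases hx' : 1 - x = 0
  · simp [hx']
  rcases quadraticChar_dichotomy hx with h | h <;>
    rcases quadraticChar_dichotomy hx' with h' | h' <;> simp [h, h', hx, hx']

theorem one_sub_mem_alike {x : F} (hx : x ∈ alike F) : 1 - x ∈ alike F := by
  rw [mem_alike] at hx ⊢
  rw [sub_sub_cancel]
  exact ⟨hx.2.1, hx.1, hx.2.2.symm⟩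

theorem one_sub_mem_unlike {x : F} (hx : x ∈ unlike F) : 1 - x ∈ unlike F := by
  rw [mem_unlike] at hx ⊢
  rw [sub_sub_cancel, hx.2.2, neg_neg]
  exact ⟨hx.2.1, hx.1, rfl⟩

theorem sum_eq_sum_alike_add_sum_unlike (f : F → ℤ) :
    ∑ x, f x = f 0 + f 1 + ∑ x ∈ alike F, f x + ∑ x ∈ unlike F, f x := by
  have hsplit (x : F) : f x = (if x = 0 then f x else 0) + (if x = 1 then f x else 0) +
      (if quadraticChar F x * quadraticChar F (1 - x) = 1 then f x else 0) +
      (if quadraticChar F x * quadraticChar F (1 - x) = -1 then f x else 0) := by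
    by_cases hx : x = 0
    · simp [hx]
    by_cases hx1 : x = 1
    · simp [hx1]
    have hx' : 1 - x ≠ 0 := fun h => hx1 (sub_eq_zero.mp h).symm
    rcases quadraticChar_dichotomy hx with h | h <;>
      rcases quadraticChar_dichotomy hx' with h' | h' <;> simp [h, h', hx, hx1]
  rw [sum_congr rfl fun x _ => hsplit x]
  simp only [sum_add_distrib, sum_ite_eq', mem_univ, if_true, alike, unlike, sum_filter]

theorem pairSum_mul_of_mem_alike (hq3 : Fintype.card F % 4 = 3) {d : ℕ}
    (hd : d = (Fintype.card F - 3) / 2) {x : F} (hx : x ∈ alike F) :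
    pairSum d x * (x * (1 - x)) = (quadraticChar F x : F) := by
  rw [pairSum_mul hq3 hd, (mem_alike.mp hx).2.2]
  ring

theorem pairSum_mul_of_mem_unlike (hq3 : Fintype.card F % 4 = 3) {d : ℕ}
    (hd : d = (Fintype.card F - 3) / 2) {x : F} (hx : x ∈ unlike F) :
    pairSum d x * (x * (1 - x)) = (quadraticChar F x : F) * (1 - 2 * x) := by
  rw [pairSum_mul hq3 hd, (mem_unlike.mp hx).2.2]
  push_cast
  ring

theorem eq_or_eq_one_sub_of_mem_alike (hq3 : Fintype.card F % 4 = 3) {d : ℕ}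
    (hd : d = (Fintype.card F - 3) / 2) {x z : F} (hx : x ∈ alike F) (hz : z ∈ alike F)
    (h : pairSum d z = pairSum d x) : z = x ∨ z = 1 - x := by
  have ex := pairSum_mul_of_mem_alike hq3 hd hx
  have ez := pairSum_mul_of_mem_alike hq3 hd hz
  rw [h] at ez
  obtain ⟨hx0, hx1, hxx⟩ := mem_alike.mp hx
  obtain ⟨hz0, hz1, hzz⟩ := mem_alike.mp hz
  have hcross : (quadraticChar F x : F) * (z * (1 - z)) =
      (quadraticChar F z : F) * (x * (1 - x)) := by
    rw [← ex, ← ez]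
    ring
  have hsame : z * (1 - z) = x * (1 - x) → z = x ∨ z = 1 - x := by
    intro he
    have : (z - x) * (z - (1 - x)) = 0 := by linear_combination -he
    rcases mul_eq_zero.mp this with h | h
    · exact Or.inl (sub_eq_zero.mp h)
    · exact Or.inr (sub_eq_zero.mp h)
  have hopp : z * (1 - z) ≠ -(x * (1 - x)) := by
    intro he
    have := congrArg (quadraticChar F) he
    rw [quadraticChar_neg_of_card_mod_four hq3, map_mul, map_mul, hxx, hzz, ← sq, ← sq,
      quadraticChar_sq_one hx0, quadraticChar_sq_one hz0] at this
    norm_num at this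
  rcases quadraticChar_dichotomy hx0 with h | h <;>
    rcases quadraticChar_dichotomy hz0 with h' | h' <;> rw [h, h'] at hcross <;>
    push_cast at hcross
  · exact hsame (by linear_combination hcross)
  · exact absurd (by linear_combination hcross) hopp
  · exact absurd (by linear_combination -hcross) hopp
  · exact hsame (by linear_combination -hcross)

theorem eq_or_eq_one_sub_of_mem_unlike (hq3 : Fintype.card F % 4 = 3) {d : ℕ}
    (hd : d = (Fintype.card F - 3) / 2) {x z : F} (hx : x ∈ unlike F) (hz : z ∈ unlike F)
    (h : pairSum d z = pairSum d x) : z = x ∨ z = 1 - x := by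
  have key (z : F) (hz : z ∈ unlike F) (h : pairSum d z = pairSum d x)
      (hxz : quadraticChar F z = quadraticChar F x) : z = x := by
    have ex := pairSum_mul_of_mem_unlike hq3 hd hx
    have ez := pairSum_mul_of_mem_unlike hq3 hd hz
    obtain ⟨hx0, hx1, hxx⟩ := mem_unlike.mp hx
    obtain ⟨hz0, hz1, hzz⟩ := mem_unlike.mp hz
    rw [h, hxz] at ez
    have hne : (quadraticChar F x : F) ≠ 0 := by
      rcases quadraticChar_dichotomy hx0 with h | h <;> simp [h]
    have hcross : (1 - 2 * x) * (z * (1 - z)) = (1 - 2 * z) * (x * (1 - x)) := by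
      apply mul_left_cancel₀ hne
      linear_combination (-(z * (1 - z))) * ex + (x * (1 - x)) * ez
    have hfac : (z - x) * ((1 - x) * (1 - z) + x * z) = 0 := by
      linear_combination hcross
    rcases mul_eq_zero.mp hfac with h | h
    · exact sub_eq_zero.mp h
    · have h' : (1 - x) * (1 - z) = -(x * z) := by linear_combination h
      have := congrArg (quadraticChar F) h'
      rw [quadraticChar_neg_of_card_mod_four hq3, map_mul, map_mul, hxx, hzz, hxz, neg_mul_neg,
        ← sq, quadraticChar_sq_one hx0] at this
      norm_num at this
  obtain ⟨hx0, -, -⟩ := mem_unlike.mp hx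
  obtain ⟨hz0, -, hzz⟩ := mem_unlike.mp hz
  by_cases hc : quadraticChar F z = quadraticChar F x
  · exact Or.inl (key z hz h hc)
  · right
    have : quadraticChar F (1 - z) = quadraticChar F x := by
      rcases quadraticChar_dichotomy hx0 with h | h <;>
        rcases quadraticChar_dichotomy hz0 with h' | h' <;> simp_all
    have := key (1 - z) (one_sub_mem_unlike hz) (by rw [pairSum_one_sub, h]) this
    rw [← this]
    ring

theorem pairSum_ne_one_of_mem_alike (hq3 : Fintype.card F % 4 = 3) {d : ℕ}
    (hd : d = (Fintype.card F - 3) / 2) {x : F} (hx : x ∈ alike F) : pairSum d x ≠ 1 := by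
  intro h
  have ex := pairSum_mul_of_mem_alike hq3 hd hx
  obtain ⟨hx0, hx1, hxx⟩ := mem_alike.mp hx
  have hsq : quadraticChar F (x * (1 - x)) = 1 := by
    rw [map_mul, hxx, ← sq, quadraticChar_sq_one hx0]
  rw [h, one_mul] at ex
  rcases quadraticChar_dichotomy hx0 with hc | hc <;> rw [hc] at ex <;> push_cast at ex
  · have h3 : x ^ 2 * x = -1 := by linear_combination (-1 - x) * ex
    have := congrArg (quadraticChar F) h3
    rw [quadraticChar_neg_of_card_mod_four hq3, map_mul, quadraticChar_sq_one' hx0, hc,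
      map_one] at this
    norm_num at this
  · rw [ex, quadraticChar_neg_of_card_mod_four hq3, map_one] at hsq
    norm_num at hsq

/-- Exactly two points of `unlike F` have `pairSum` equal to `1` when `5` is a square. -/
theorem card_unlike_pairSum_eq_one (hq3 : Fintype.card F % 4 = 3) {d : ℕ}
    (hd : d = (Fintype.card F - 3) / 2) (h5sq : IsSquare (5 : F)) :
    ((unlike F).filter fun z => pairSum d z = 1).card = 2 := by
  have h2 : (2 : F) ≠ 0 := two_ne_zero_of_card_mod_four hq3
  obtain ⟨r, hr⟩ := h5sq
  have hex : ∃ x : F, x ^ 2 - 3 * x + 1 = 0 ∧ quadraticChar F x = 1 ∧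
      quadraticChar F (1 - x) = -1 := by
    have hroot (s : F) (hs : 5 = s * s) : ((1 + s) / 2) ^ 2 ≠ 0 ∧
        (((1 + s) / 2) ^ 2) ^ 2 - 3 * ((1 + s) / 2) ^ 2 + 1 = 0 := by
      constructor
      · intro h0
        have h1 : 1 + s = 0 := by
          have := pow_eq_zero_iff (two_ne_zero) |>.mp h0
          simpa [h2] using this
        have h4 : (2 : F) * 2 = 0 := by linear_combination hs - (1 - s) * h1
        exact mul_ne_zero h2 h2 h4
      · field_simp
        linear_combination (-(s ^ 2) - 4 * s - 3 + 4) * hs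
    have hs' : (5 : F) = -r * -r := by linear_combination hr
    obtain ⟨a0, a1⟩ := hroot r hr
    obtain ⟨b0, b1⟩ := hroot (-r) hs'
    have hprod : (1 - ((1 + r) / 2) ^ 2) * (1 - ((1 + -r) / 2) ^ 2) = -1 := by
      field_simp
      linear_combination (5 - r ^ 2) * hr
    have hchar := congrArg (quadraticChar F) hprod
    rw [quadraticChar_neg_of_card_mod_four hq3, map_mul, map_one] at hchar
    have ha : 1 - ((1 + r) / 2) ^ 2 ≠ 0 := by
      intro h
      rw [h] at hchar
      simp at hchar
    rcases quadraticChar_dichotomy ha with h | h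
    · refine ⟨_, b1, quadraticChar_sq_one' (pow_ne_zero_iff two_ne_zero |>.mp b0), ?_⟩
      rw [h] at hchar
      omega
    · exact ⟨_, a1, quadraticChar_sq_one' (pow_ne_zero_iff two_ne_zero |>.mp a0), h⟩
  obtain ⟨x, hx, hc, hc'⟩ := hex
  have hx0 : x ≠ 0 := by
    rintro rfl
    simp at hc
  have hx1 : 1 - x ≠ 0 := by
    intro h
    simp [h] at hc'
  have hxu : x ∈ unlike F := mem_unlike.mpr ⟨hx0, hx1, by rw [hc, hc']⟩
  have hpx : pairSum d x = 1 := by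
    have := pairSum_mul_of_mem_unlike hq3 hd hxu
    rw [hc] at this
    apply mul_right_cancel₀ (mul_ne_zero hx0 hx1)
    push_cast at this
    linear_combination this + hx
  have hne : x ≠ 1 - x := by
    intro h
    rw [← h, hc] at hc'
    norm_num at hc'
  have : ((unlike F).filter fun z => pairSum d z = 1) = {x, 1 - x} := by
    ext z
    simp only [mem_filter, mem_insert, mem_singleton]
    constructor
    · rintro ⟨hz, hpz⟩
      exact eq_or_eq_one_sub_of_mem_unlike hq3 hd hxu hz (by rw [hpz, hpx])
    · rintro (rfl | rfl)
      · exact ⟨hxu, hpx⟩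
      · exact ⟨one_sub_mem_unlike hxu, by rw [pairSum_one_sub, hpx]⟩
  rw [this, card_pair hne]

theorem card_alike_collisions (hq3 : Fintype.card F % 4 = 3) {d : ℕ}
    (hd : d = (Fintype.card F - 3) / 2) {x : F} (hx : x ∈ alike F) :
    (((alike F).filter fun z => pairSum d z = pairSum d x).card : ℤ) =
      2 - if x = 1 / 2 then 1 else 0 := by
  have h2 : (2 : F) ≠ 0 := two_ne_zero_of_card_mod_four hq3
  have : ((alike F).filter fun z => pairSum d z = pairSum d x) = {x, 1 - x} := by
    ext z
    simp only [mem_filter, mem_insert, mem_singleton]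
    constructor
    · rintro ⟨hz, hpz⟩
      exact eq_or_eq_one_sub_of_mem_alike hq3 hd hx hz hpz
    · rintro (rfl | rfl)
      · exact ⟨hx, rfl⟩
      · exact ⟨one_sub_mem_alike hx, pairSum_one_sub d x⟩
  rw [this]
  split_ifs with h
  · have : 1 - x = x := by
      rw [h]
      field_simp
      ring
    simp [this]
  · rw [card_pair]
    · rfl
    · intro h'
      apply h
      field_simp
      linear_combination h'

theorem card_unlike_collisions (hq3 : Fintype.card F % 4 = 3) {d : ℕ}
    (hd : d = (Fintype.card F - 3) / 2) {x : F} (hx : x ∈ unlike F) :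
    ((unlike F).filter fun z => pairSum d z = pairSum d x).card = 2 := by
  have : ((unlike F).filter fun z => pairSum d z = pairSum d x) = {x, 1 - x} := by
    ext z
    simp only [mem_filter, mem_insert, mem_singleton]
    constructor
    · rintro ⟨hz, hpz⟩
      exact eq_or_eq_one_sub_of_mem_unlike hq3 hd hx hz hpz
    · rintro (rfl | rfl)
      · exact ⟨hx, rfl⟩
      · exact ⟨one_sub_mem_unlike hx, pairSum_one_sub d x⟩
  rw [this, card_pair]
  intro h
  obtain ⟨hx0, -, hxx⟩ := mem_unlike.mp hx
  rw [← h] at hxx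
  rcases quadraticChar_dichotomy hx0 with h | h <;> rw [h] at hxx <;> norm_num at hxx

theorem half_mem_alike (hq3 : Fintype.card F % 4 = 3) : (1 / 2 : F) ∈ alike F := by
  have h2 : (2 : F) ≠ 0 := two_ne_zero_of_card_mod_four hq3
  have : (1 : F) - 1 / 2 = 1 / 2 := by
    field_simp
    ring
  rw [mem_alike, this]
  exact ⟨one_div_ne_zero h2, one_div_ne_zero h2, rfl⟩

end Collisions

section Mixed

variable {F : Type*} [Field F] [Fintype F] [DecidableEq F]

theorem quadraticChar_eq_of_mul_eq_sq {x y s : F} (hx : x ≠ 0) (hy : y ≠ 0)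
    (h : x * y = s ^ 2) : quadraticChar F x = quadraticChar F y := by
  have hs : s ≠ 0 := by
    rintro rfl
    exact mul_ne_zero hx hy (by rw [h]; ring)
  have := congrArg (quadraticChar F) h
  rw [map_mul, quadraticChar_sq_one' hs] at this
  rcases quadraticChar_dichotomy hx with h | h <;>
    rcases quadraticChar_dichotomy hy with h' | h' <;> simp_all

/-- For `x` in `alike F` with `t ^ 2 = 4 x (1 - x)`, the number of `z` in `unlike F` that collide
with `x` under `pairSum` and have the same quadratic character as `x`. -/
theorem card_mixed_half (hq3 : Fintype.card F % 4 = 3) {x t : F} (hx : x ∈ alike F)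
    (ht : t ^ 2 = 4 * (x * (1 - x))) :
    4 * ((univ.filter fun z : F => quadraticChar F z = quadraticChar F x ∧
        quadraticChar F (1 - z) = -quadraticChar F x ∧
        z * (1 - z) = x * (1 - x) * (1 - 2 * z)).card : ℤ) =
      (1 + quadraticChar F (t ^ 2 + 2 * t + 2) * quadraticChar F (t ^ 2 - 2 * t + 2)) *
        (1 + quadraticChar F 2 * quadraticChar F (t ^ 2 + 2 * t + 2) * quadraticChar F x) := by
  have h2 : (2 : F) ≠ 0 := two_ne_zero_of_card_mod_four hq3
  obtain ⟨hx0, hx1, hxx⟩ := mem_alike.mp hx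
  set w := x * (1 - x) with hw
  have hw0 : w ≠ 0 := mul_ne_zero hx0 hx1
  have hwsq : quadraticChar F w = 1 := by
    rw [hw, map_mul, hxx, ← sq, quadraticChar_sq_one hx0]
  have hP : t ^ 2 + 2 * t + 2 ≠ 0 := by
    have := sq_add_one_ne_zero_of_card_mod_four hq3 (t + 1)
    intro h
    apply this
    linear_combination h
  have hQ : t ^ 2 - 2 * t + 2 ≠ 0 := by
    have := sq_add_one_ne_zero_of_card_mod_four hq3 (t - 1)
    intro h
    apply this
    linear_combination h
  have hPQ : (t ^ 2 + 2 * t + 2) * (t ^ 2 - 2 * t + 2) = (1 + 4 * w ^ 2) * 2 ^ 2 := by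
    linear_combination (t ^ 2 + 4 * w) * ht
  have hroot (z : F) (hz : z * (1 - z) = w * (1 - 2 * z)) :
      quadraticChar F z = quadraticChar F 2 * quadraticChar F (t ^ 2 + 2 * t + 2) := by
    rw [← map_mul]
    have hz0 : z ≠ 0 := by
      rintro rfl
      apply hw0
      linear_combination -hz
    refine quadraticChar_eq_of_mul_eq_sq (s := 2 * z + t) hz0 (mul_ne_zero h2 hP) ?_
    linear_combination (2 * z - 1) * ht + 4 * hz
  rcases quadraticChar_dichotomy (mul_ne_zero hP hQ) with hd | hd
  · rw [← map_mul, hd]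
    by_cases hk : quadraticChar F 2 * quadraticChar F (t ^ 2 + 2 * t + 2) = quadraticChar F x
    · obtain ⟨s, hs⟩ := (quadraticChar_one_iff_isSquare (mul_ne_zero hP hQ)).mp hd
      have key : ∃ y z : F, y + z = 1 + 2 * w ∧ y * z = w ∧
          quadraticChar F (1 - y) = -quadraticChar F x := by
        have h4 : (4 : F) ≠ 0 := by
          rw [show (4 : F) = 2 * 2 by norm_num]
          exact mul_ne_zero h2 h2
        have hsum : (1 + 2 * w + s / 2) / 2 + (1 + 2 * w - s / 2) / 2 = 1 + 2 * w := by
          field_simp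
          ring
        have hmul : (1 + 2 * w + s / 2) / 2 * ((1 + 2 * w - s / 2) / 2) = w := by
          field_simp
          linear_combination hs - hPQ
        generalize (1 + 2 * w + s / 2) / 2 = y at hsum hmul
        generalize (1 + 2 * w - s / 2) / 2 = z at hsum hmul
        have h1 : (1 - y) * (1 - z) = -w := by linear_combination hmul - hsum
        have h1' := congrArg (quadraticChar F) h1
        rw [quadraticChar_neg_of_card_mod_four hq3, hwsq, map_mul] at h1'
        by_cases hy : quadraticChar F (1 - y) = -quadraticChar F x
        · exact ⟨y, z, hsum, hmul, hy⟩
        · refine ⟨z, y, by rw [add_comm, hsum], by rw [mul_comm, hmul], ?_⟩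
          have hy0 : 1 - y ≠ 0 := by
            intro h
            rw [h] at h1'
            simp at h1'
          rcases quadraticChar_dichotomy hy0 with h | h <;>
            rcases quadraticChar_dichotomy hx0 with h' | h' <;> rw [h] at h1' hy <;>
            rw [h'] at hy ⊢ <;> omega
      obtain ⟨y, z, hsum, hmul, hy⟩ := key
      have hset : (univ.filter fun z : F => quadraticChar F z = quadraticChar F x ∧
          quadraticChar F (1 - z) = -quadraticChar F x ∧
          z * (1 - z) = w * (1 - 2 * z)) = {y} := by
        ext u
        simp only [mem_filter, mem_univ, true_and, mem_singleton]
        constructor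
        · rintro ⟨-, hu, hu'⟩
          have : (u - y) * (u - z) = 0 := by
            linear_combination -hu' + hmul - u * hsum
          rcases mul_eq_zero.mp this with h | h
          · exact sub_eq_zero.mp h
          · have huz : u = z := sub_eq_zero.mp h
            have h1 : (1 - y) * (1 - z) = -w := by linear_combination hmul - hsum
            have h1' := congrArg (quadraticChar F) h1
            rw [quadraticChar_neg_of_card_mod_four hq3, hwsq, map_mul, hy, ← huz, hu,
              neg_mul_neg, ← sq, quadraticChar_sq_one hx0] at h1'
            norm_num at h1'
        · rintro rfl
          have he : u * (1 - u) = w * (1 - 2 * u) := by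
            linear_combination hmul - u * hsum
          exact ⟨by rw [hroot u he, hk], hy, he⟩
      rw [hset, hk, ← sq, quadraticChar_sq_one hx0]
      norm_num
    · rw [filter_eq_empty_iff.mpr]
      · have hkp : quadraticChar F 2 * quadraticChar F (t ^ 2 + 2 * t + 2) =
            -quadraticChar F x := by
          rw [← map_mul] at hk ⊢
          rcases quadraticChar_dichotomy (mul_ne_zero h2 hP) with h | h <;>
            rcases quadraticChar_dichotomy hx0 with h' | h' <;> rw [h, h'] at hk <;>
            simp_all
        rw [hkp, neg_mul, ← sq, quadraticChar_sq_one hx0]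
        norm_num
      · rintro z - ⟨hz, -, hz'⟩
        exact hk (by rw [← hroot z hz', hz])
  · rw [← map_mul, hd, filter_eq_empty_iff.mpr]
    · norm_num
    · rintro z - ⟨-, -, hz'⟩
      rw [quadraticChar_neg_one_iff_not_isSquare] at hd
      apply hd
      refine ⟨2 * (2 * z - 1 - 2 * w), ?_⟩
      linear_combination hPQ + 16 * hz'

theorem card_mixed (hq3 : Fintype.card F % 4 = 3) {d : ℕ}
    (hd : d = (Fintype.card F - 3) / 2) {x t : F} (hx : x ∈ alike F)
    (ht : t ^ 2 = 4 * (x * (1 - x))) :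
    2 * (((unlike F).filter fun z => pairSum d z = pairSum d x).card : ℤ) =
      (1 + quadraticChar F (t ^ 2 + 2 * t + 2) * quadraticChar F (t ^ 2 - 2 * t + 2)) *
        (1 + quadraticChar F 2 * quadraticChar F (t ^ 2 + 2 * t + 2) * quadraticChar F x) := by
  rw [← card_mixed_half hq3 hx ht]
  obtain ⟨hx0, hx1, hxx⟩ := mem_alike.mp hx
  have ex := pairSum_mul_of_mem_alike hq3 hd hx
  have hne : (quadraticChar F x : F) ≠ 0 := by
    rcases quadraticChar_dichotomy hx0 with h | h <;> simp [h]
  set Z := univ.filter fun z : F => quadraticChar F z = quadraticChar F x ∧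
        quadraticChar F (1 - z) = -quadraticChar F x ∧
        z * (1 - z) = x * (1 - x) * (1 - 2 * z) with hZ
  have same : (((unlike F).filter fun z => pairSum d z = pairSum d x).filter
      fun z => quadraticChar F z = quadraticChar F x) = Z := by
    ext z
    simp only [hZ, mem_filter, mem_univ, true_and]
    constructor
    · rintro ⟨⟨hz, hp⟩, hzx⟩
      refine ⟨hzx, by rw [(mem_unlike.mp hz).2.2, hzx], ?_⟩
      have ez := pairSum_mul_of_mem_unlike hq3 hd hz
      rw [hp, hzx] at ez
      apply mul_left_cancel₀ hne
      linear_combination (-(z * (1 - z))) * ex + (x * (1 - x)) * ez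
    · rintro ⟨hzx, hz1, he⟩
      have hz0 : z ≠ 0 := by
        rintro rfl
        rw [MulChar.map_zero] at hzx
        exact hx0 (quadraticChar_eq_zero_iff.mp hzx.symm)
      have hz1' : 1 - z ≠ 0 := by
        intro h
        rw [h, MulChar.map_zero, zero_eq_neg] at hz1
        exact hx0 (quadraticChar_eq_zero_iff.mp hz1)
      have hz : z ∈ unlike F := mem_unlike.mpr ⟨hz0, hz1', by rw [hz1, hzx]⟩
      refine ⟨⟨hz, ?_⟩, hzx⟩
      have ez := pairSum_mul_of_mem_unlike hq3 hd hz
      rw [hzx] at ez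
      apply mul_right_cancel₀ (mul_ne_zero (mul_ne_zero hz0 hz1') (mul_ne_zero hx0 hx1))
      linear_combination (x * (1 - x)) * ez - (z * (1 - z)) * ex -
        (quadraticChar F x : F) * he
  have opp : (((unlike F).filter fun z => pairSum d z = pairSum d x).filter
      fun z => ¬ quadraticChar F z = quadraticChar F x).card = Z.card := by
    rw [← same]
    have hflip {z : F} (hz : z ∈ unlike F) :
        quadraticChar F (1 - z) = quadraticChar F x ↔
          ¬ quadraticChar F z = quadraticChar F x := by
      obtain ⟨hz0, -, hzz⟩ := mem_unlike.mp hz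
      rw [hzz]
      rcases quadraticChar_dichotomy hx0 with h | h <;>
        rcases quadraticChar_dichotomy hz0 with h' | h' <;> rw [h, h'] <;> norm_num
    refine card_nbij' (fun z => 1 - z) (fun z => 1 - z) ?_ ?_ ?_ ?_
    · intro z hz
      simp only [coe_filter, mem_filter, Set.mem_ofPred_eq] at hz ⊢
      exact ⟨⟨one_sub_mem_unlike hz.1.1, by rw [pairSum_one_sub, hz.1.2]⟩,
        (hflip hz.1.1).mpr hz.2⟩
    · intro z hz
      simp only [coe_filter, mem_filter, Set.mem_ofPred_eq] at hz ⊢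
      refine ⟨⟨one_sub_mem_unlike hz.1.1, by rw [pairSum_one_sub, hz.1.2]⟩, ?_⟩
      rw [← hflip (one_sub_mem_unlike hz.1.1), sub_sub_cancel]
      exact hz.2
    · intro z _
      exact sub_sub_cancel 1 z
    · intro z _
      exact sub_sub_cancel 1 z
  rw [← card_filter_add_card_filter_not (fun z => quadraticChar F z = quadraticChar F x), same,
    opp]
  push_cast
  ring

theorem card_filter_sq_eq (hF : ringChar F ≠ 2) (t : F) :
    ((univ.filter fun x : F => t ^ 2 = 4 * (x * (1 - x))).card : ℤ) =
      1 + quadraticChar F (1 + t) * quadraticChar F (1 - t) := by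
  have h2 : (2 : F) ≠ 0 := Ring.two_ne_zero hF
  have h4 : (4 : F) ≠ 0 := by
    rw [show (4 : F) = 2 * 2 by norm_num]
    exact mul_ne_zero h2 h2
  have h := card_quadratic hF 1 (t ^ 2 / 4)
  rw [← map_mul, show (1 + t) * (1 - t) = 1 ^ 2 - 4 * (t ^ 2 / 4) by field_simp; ring, ← h]
  congr 2
  ext x
  simp only [mem_filter, mem_univ, true_and]
  constructor
  · intro h
    field_simp
    linear_combination h
  · intro h
    field_simp at h
    linear_combination h

theorem sum_filter_sq_eq (hF : ringChar F ≠ 2) {t : F} (ht : t ≠ 0) :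
    ∑ x ∈ univ.filter (fun x : F => t ^ 2 = 4 * (x * (1 - x))), quadraticChar F x =
      quadraticChar F (1 + t) + quadraticChar F (1 - t) := by
  have h2 : (2 : F) ≠ 0 := Ring.two_ne_zero hF
  have key (s : F) (hs : s ^ 2 = t ^ 2) (hs1 : 1 + s ≠ 0) (x : F)
      (hx : x ∈ univ.filter (fun x : F => t ^ 2 = 4 * (x * (1 - x)))) :
      quadraticChar F x = quadraticChar F (1 + s) := by
    simp only [mem_filter, mem_univ, true_and] at hx
    have hx0 : x ≠ 0 := by
      rintro rfl
      apply ht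
      simpa using hx
    refine quadraticChar_eq_of_mul_eq_sq (s := x + s / 2) hx0 hs1 ?_
    field_simp
    linear_combination -hs - hx
  by_cases h1 : 1 + t = 0
  · have hs1 : 1 + -t ≠ 0 := by
      intro h
      apply h2
      linear_combination h + h1
    rw [sum_congr rfl (key (-t) (neg_sq t) hs1), sum_const, nsmul_eq_mul,
      card_filter_sq_eq hF, h1, MulChar.map_zero, ← sub_eq_add_neg]
    ring
  · rw [sum_congr rfl (key t rfl h1), sum_const, nsmul_eq_mul, card_filter_sq_eq hF]
    linear_combination quadraticChar F (1 - t) * quadraticChar_sq_one h1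

theorem sum_card_mixed (hq3 : Fintype.card F % 4 = 3) {d : ℕ}
    (hd : d = (Fintype.card F - 3) / 2) :
    4 * ∑ x ∈ alike F, (((unlike F).filter fun z => pairSum d z = pairSum d x).card : ℤ) + 8 =
      ∑ t : F, mixedWeight t := by
  have hF := ringChar_ne_two_of_card_mod_four hq3
  have h2 : (2 : F) ≠ 0 := Ring.two_ne_zero hF
  have h0 : mixedWeight (0 : F) = 8 := by
    have : quadraticChar F 2 * quadraticChar F 2 = 1 := by
      rw [← sq, quadraticChar_sq_one h2]
    simp only [mixedWeight, add_zero, sub_zero, map_one, mul_zero, ne_eq, OfNat.ofNat_ne_zero,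
      not_false_eq_true, zero_pow, zero_add]
    linear_combination 6 * this
  rw [← sum_erase_add univ _ (mem_univ (0 : F)), h0]
  congr 1
  have hx (x : F) (hx : x ∈ alike F) :
      4 * (((unlike F).filter fun z => pairSum d z = pairSum d x).card : ℤ) =
        ∑ t ∈ univ.erase (0 : F), if t ^ 2 = 4 * (x * (1 - x)) then
          (1 + quadraticChar F (t ^ 2 + 2 * t + 2) * quadraticChar F (t ^ 2 - 2 * t + 2)) *
          (1 + quadraticChar F 2 * quadraticChar F (t ^ 2 + 2 * t + 2) * quadraticChar F x)
        else 0 := by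
    obtain ⟨hx0, hx1, hxx⟩ := mem_alike.mp hx
    have hw : 4 * (x * (1 - x)) ≠ 0 := by
      rw [show (4 : F) = 2 * 2 by norm_num]
      exact mul_ne_zero (mul_ne_zero h2 h2) (mul_ne_zero hx0 hx1)
    have hchar : quadraticChar F (4 * (x * (1 - x))) = 1 := by
      rw [show 4 * (x * (1 - x)) = x * (1 - x) * 2 ^ 2 by ring, quadraticChar_mul_sq _ h2,
        map_mul, hxx, ← sq, quadraticChar_sq_one hx0]
    have hcard := quadraticChar_card_sqrts hF (4 * (x * (1 - x)))
    rw [hchar] at hcard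
    have hset : (univ.erase (0 : F)).filter (fun t => t ^ 2 = 4 * (x * (1 - x))) =
        {t : F | t ^ 2 = 4 * (x * (1 - x))}.toFinset := by
      ext t
      simp only [mem_filter, mem_erase, mem_univ, and_true, Set.mem_toFinset, Set.mem_ofPred_eq,
        and_iff_right_iff_imp]
      rintro ht rfl
      exact hw (by rw [← ht]; ring)
    rw [← sum_filter, sum_congr rfl (fun t ht => (card_mixed hq3 hd hx (mem_filter.mp ht).2).symm),
      sum_const, hset, nsmul_eq_mul, hcard]
    ring
  rw [mul_sum, sum_congr rfl hx, sum_comm]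
  refine sum_congr rfl fun t ht => ?_
  have ht0 : t ≠ 0 := ne_of_mem_erase ht
  have hset : (alike F).filter (fun x => t ^ 2 = 4 * (x * (1 - x))) =
      univ.filter (fun x : F => t ^ 2 = 4 * (x * (1 - x))) := by
    ext x
    simp only [mem_filter, mem_univ, true_and, and_iff_right_iff_imp]
    intro hx
    have hx0 : x ≠ 0 := by
      rintro rfl
      exact ht0 (by simpa using hx)
    have hx1 : 1 - x ≠ 0 := by
      intro h
      rw [h] at hx
      exact ht0 (by simpa using hx)
    refine mem_alike.mpr ⟨hx0, hx1, ?_⟩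
    refine quadraticChar_eq_of_mul_eq_sq (s := t / 2) hx1 hx0 ?_
    field_simp
    linear_combination -hx
  rw [← sum_filter, hset, ← mul_sum, sum_add_distrib, ← mul_sum, sum_filter_sq_eq hF ht0,
    sum_const, nsmul_eq_mul, card_filter_sq_eq hF, mixedWeight]
  have hP : t ^ 2 + 2 * t + 2 ≠ 0 := by
    have := sq_add_one_ne_zero_of_card_mod_four hq3 (t + 1)
    intro h
    apply this
    linear_combination h
  linear_combination (quadraticChar F 2 * quadraticChar F (t ^ 2 - 2 * t + 2) *
    (quadraticChar F (1 + t) + quadraticChar F (1 - t))) * quadraticChar_sq_one hP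

theorem card_pairSum_collisions (hq3 : Fintype.card F % 4 = 3) (hq : 3 < Fintype.card F) {d : ℕ}
    (hd : d = (Fintype.card F - 3) / 2) (h5sq : IsSquare (5 : F)) :
    2 * ((univ.filter fun p : F × F => pairSum d p.2 = pairSum d p.1).card : ℤ) =
      4 * Fintype.card F + 6 + ∑ t : F, mixedWeight t := by
  have hd0 : d ≠ 0 := by omega
  have hcardsum : ((univ.filter fun p : F × F => pairSum d p.2 = pairSum d p.1).card : ℤ) =
      ∑ x : F, ∑ z : F, if pairSum d z = pairSum d x then 1 else 0 := by
    rw [← sum_boole, Fintype.sum_prod_type]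
  have hB : ∑ z ∈ unlike F, (if pairSum d z = 1 then (1 : ℤ) else 0) = 2 := by
    rw [sum_boole, card_unlike_pairSum_eq_one hq3 hd h5sq]
    rfl
  have hA : ∑ z ∈ alike F, (if pairSum d z = 1 then (1 : ℤ) else 0) = 0 :=
    sum_eq_zero fun z hz => if_neg (pairSum_ne_one_of_mem_alike hq3 hd hz)
  have hAA : ∑ x ∈ alike F, ∑ z ∈ alike F,
      (if pairSum d z = pairSum d x then (1 : ℤ) else 0) = 2 * (alike F).card - 1 := by
    rw [sum_congr rfl fun x hx => (sum_boole _ _).trans (card_alike_collisions hq3 hd hx),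
      sum_sub_distrib, sum_ite_eq', if_pos (half_mem_alike hq3), sum_const, nsmul_eq_mul]
    ring
  have hBB : ∑ x ∈ unlike F, ∑ z ∈ unlike F,
      (if pairSum d z = pairSum d x then (1 : ℤ) else 0) = 2 * (unlike F).card := by
    rw [sum_congr rfl fun x hx => (sum_boole _ _).trans
      (congrArg Nat.cast (card_unlike_collisions hq3 hd hx)), sum_const, nsmul_eq_mul]
    push_cast
    ring
  have hAB : ∑ x ∈ unlike F, ∑ z ∈ alike F,
      (if pairSum d z = pairSum d x then (1 : ℤ) else 0) =
      ∑ x ∈ alike F, ∑ z ∈ unlike F, (if pairSum d z = pairSum d x then (1 : ℤ) else 0) := by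
    rw [sum_comm]
    simp only [eq_comm]
  have hmix := sum_card_mixed hq3 hd (F := F)
  rw [sum_congr rfl fun x _ => (sum_boole (R := ℤ) _ _).symm] at hmix
  have hcard := sum_eq_sum_alike_add_sum_unlike (F := F) fun _ => 1
  simp only [sum_const, nsmul_eq_mul, mul_one, card_univ] at hcard
  rw [hcardsum, sum_congr rfl fun x _ => sum_eq_sum_alike_add_sum_unlike _,
    sum_eq_sum_alike_add_sum_unlike]
  simp only [pairSum_zero hd0, pairSum_one hd0, if_true, sum_add_distrib, hA, hB, hAA, hBB, hAB,
    @eq_comm F 1]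
  linarith

end Mixed

section Quadruples

variable {F : Type*} [Field F] [Fintype F] [DecidableEq F]

theorem pow_eq_pow_iff_eq_or_eq_neg (hq3 : Fintype.card F % 4 = 3) (hq : 3 < Fintype.card F)
    {d : ℕ} (hd : d = (Fintype.card F - 3) / 2) (x y : F) :
    x ^ d = y ^ d ↔ x = y ∨ x = -y := by
  have hd0 : d ≠ 0 := by omega
  have heven : Even d := ⟨(Fintype.card F - 3) / 4, by omega⟩
  constructor
  · intro h
    by_cases hx : x = 0
    · rw [hx, zero_pow hd0] at h
      left
      rw [hx, pow_eq_zero_iff hd0 |>.mp h.symm]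
    have hy : y ≠ 0 := by
      rintro rfl
      rw [zero_pow hd0] at h
      exact hx (pow_eq_zero_iff hd0 |>.mp h)
    have hpow (u : F) (hu : u ≠ 0) : (u ^ d) ^ 2 * u ^ 2 = 1 := by
      rw [← FiniteField.pow_card_sub_one_eq_one u hu, ← pow_mul, ← pow_add]
      congr 1
      omega
    have hxd : (x ^ d) ^ 2 ≠ 0 := pow_ne_zero _ (pow_ne_zero _ hx)
    have hpx := hpow x hx
    have hpy := hpow y hy
    rw [← h, ← hpx] at hpy
    exact sq_eq_sq_iff_eq_or_eq_neg.mp (mul_left_cancel₀ hxd hpy).symm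
  · rintro (rfl | rfl)
    · rfl
    · exact heven.neg_pow y

theorem card_eq_or_eq_neg (hF : ringChar F ≠ 2) :
    ((univ.filter fun p : F × F => p.1 = p.2 ∨ p.1 = -p.2).card : ℤ) =
      2 * Fintype.card F - 1 := by
  have h2 : (2 : F) ≠ 0 := Ring.two_ne_zero hF
  have hfib (x : F) : ∑ y : F, (if x = y ∨ x = -y then (1 : ℤ) else 0) =
      2 - if x = 0 then 1 else 0 := by
    have hset : (univ.filter fun y => x = y ∨ x = -y) = {x, -x} := by
      ext y
      simp only [mem_filter, mem_univ, true_and, mem_insert, mem_singleton]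
      rw [eq_comm, @eq_comm _ x (-y), neg_eq_iff_eq_neg]
    rw [sum_boole, hset]
    split_ifs with hx
    · simp [hx]
    · rw [card_pair]
      · rfl
      · intro h
        apply hx
        have : 2 * x = 0 := by linear_combination h
        exact (mul_eq_zero.mp this).resolve_left h2
  rw [← sum_boole, Fintype.sum_prod_type]
  simp only [hfib, sum_sub_distrib, sum_ite_eq', mem_univ, if_true, sum_const, card_univ,
    nsmul_eq_mul]
  ring

theorem card_quadruples (hq3 : Fintype.card F % 4 = 3) (hq : 3 < Fintype.card F)
    {d : ℕ} (hd : d = (Fintype.card F - 3) / 2) :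
    ((univ.filter fun x : F × F × F × F => x.1 - x.2.1 + x.2.2.1 - x.2.2.2 = 0 ∧
        x.1 ^ d - x.2.1 ^ d + x.2.2.1 ^ d - x.2.2.2 ^ d = 0).card : ℤ) =
      2 * Fintype.card F - 1 + (Fintype.card F - 1) *
        (univ.filter fun p : F × F => pairSum d p.2 = pairSum d p.1).card := by
  have hF := ringChar_ne_two_of_card_mod_four hq3
  have h2 : (2 : F) ≠ 0 := Ring.two_ne_zero hF
  have heven : Even d := ⟨(Fintype.card F - 3) / 4, by omega⟩
  rw [← card_filter_add_card_filter_not (fun x : F × F × F × F => x.1 + x.2.2.1 = 0),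
    ← card_eq_or_eq_neg hF, filter_filter, filter_filter]
  push_cast
  congr 1
  · congr 1
    refine card_nbij' (fun x => (x.1, x.2.1)) (fun p => (p.1, p.2, -p.1, -p.2)) ?_ ?_ ?_ ?_
    · rintro ⟨a, b, c, e⟩ h
      simp only [coe_filter, mem_univ, true_and, Set.mem_ofPred_eq] at h ⊢
      obtain ⟨⟨h1, h3⟩, h4⟩ := h
      have hc : c = -a := by linear_combination h4
      have he : e = -b := by linear_combination h4 - h1
      rw [← pow_eq_pow_iff_eq_or_eq_neg hq3 hq hd]
      rw [hc, he, heven.neg_pow, heven.neg_pow] at h3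
      apply mul_left_cancel₀ h2
      linear_combination h3
    · rintro ⟨a, b⟩ h
      simp only [coe_filter, mem_univ, true_and, Set.mem_ofPred_eq] at h ⊢
      rw [← pow_eq_pow_iff_eq_or_eq_neg hq3 hq hd] at h
      refine ⟨⟨by ring, ?_⟩, by ring⟩
      rw [heven.neg_pow, heven.neg_pow]
      linear_combination 2 * h
    · rintro ⟨a, b, c, e⟩ h
      simp only [coe_filter, mem_univ, true_and, Set.mem_ofPred_eq] at h
      obtain ⟨⟨h1, h3⟩, h4⟩ := h
      simp only [Prod.mk.injEq, true_and]
      exact ⟨by linear_combination -h4, by linear_combination h1 - h4⟩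
    · rintro ⟨a, b⟩ _
      rfl
  · have hunits : ((Fintype.card F : ℤ) - 1) = (univ.erase (0 : F)).card := by
      rw [card_erase_of_mem (mem_univ _), card_univ, Nat.cast_sub Fintype.card_pos]
      rfl
    rw [hunits, ← Nat.cast_mul, ← card_product]
    congr 1
    refine card_nbij' (fun x => (x.1 + x.2.2.1, x.1 / (x.1 + x.2.2.1), x.2.1 / (x.1 + x.2.2.1)))
      (fun p => (p.1 * p.2.1, p.1 * p.2.2, p.1 * (1 - p.2.1), p.1 * (1 - p.2.2))) ?_ ?_ ?_ ?_
    · rintro ⟨a, b, c, e⟩ h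
      simp only [coe_filter, mem_univ, true_and, Set.mem_ofPred_eq, coe_product, Set.mem_prod,
        mem_coe, mem_erase, and_true, ne_eq] at h ⊢
      obtain ⟨⟨h1, h3⟩, h4⟩ := h
      refine ⟨h4, ?_⟩
      have ha : 1 - a / (a + c) = c / (a + c) := by
        field_simp
        ring
      have hb : 1 - b / (a + c) = e / (a + c) := by
        field_simp
        linear_combination h1
      rw [pairSum, pairSum, ha, hb]
      simp only [div_pow, ← add_div]
      congr 1
      linear_combination -h3
    · rintro ⟨s, x, z⟩ h
      simp only [coe_filter, mem_univ, true_and, Set.mem_ofPred_eq, coe_product, Set.mem_prod,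
        mem_coe, mem_erase, and_true, ne_eq] at h ⊢
      refine ⟨⟨by ring, ?_⟩, ?_⟩
      · simp only [mul_pow]
        have hp : z ^ d + (1 - z) ^ d = x ^ d + (1 - x) ^ d := h.2
        linear_combination -(s ^ d) * hp
      · rw [show s * x + s * (1 - x) = s by ring]
        exact h.1
    · rintro ⟨a, b, c, e⟩ h
      simp only [coe_filter, mem_univ, true_and, Set.mem_ofPred_eq] at h
      obtain ⟨⟨h1, h3⟩, h4⟩ := h
      simp only [Prod.mk.injEq]
      refine ⟨by field_simp, by field_simp, ?_, ?_⟩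
      · field_simp
        ring
      · field_simp
        linear_combination h1
    · rintro ⟨s, x, z⟩ h
      simp only [coe_product, Set.mem_prod, mem_coe, mem_erase, ne_eq] at h
      have hs : s ≠ 0 := h.1.1
      have hsum : s * x + s * (1 - x) = s := by ring
      simp only [Prod.mk.injEq, hsum, true_and]
      exact ⟨by field_simp, by field_simp⟩

end Quadruples


theorem stmt_14 (F : Type*) [Field F] [Fintype F] [DecidableEq F]
    (hq3 : Fintype.card F % 4 = 3) (hq : 3 < Fintype.card F)
    (d : ℕ) (hd : d = (Fintype.card F - 3) / 2)
    (lam : ℤ)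
    (hlam : lam = (∑ x : F, quadraticChar F (x * (x ^ 2 + 4 * x - 1))) +
        ∑ x : F, quadraticChar F (x * (x ^ 2 - 2 * x + 5)))
    (h5 : (5 : F) ≠ 0) (h5sq : IsSquare (5 : F)) :
    2 * ({x : F × F × F × F |
        x.1 - x.2.1 + x.2.2.1 - x.2.2.2 = 0 ∧
        x.1 ^ d - x.2.1 ^ d + x.2.2.1 ^ d - x.2.2.2 ^ d = 0}.ncard : ℤ) =
      5 * (Fintype.card F : ℤ) ^ 2 + (lam + 6) * (Fintype.card F : ℤ) - (lam + 9) := by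
  have hset : {x : F × F × F × F |
        x.1 - x.2.1 + x.2.2.1 - x.2.2.2 = 0 ∧
        x.1 ^ d - x.2.1 ^ d + x.2.2.1 ^ d - x.2.2.2 ^ d = 0} =
      ↑(univ.filter fun x : F × F × F × F => x.1 - x.2.1 + x.2.2.1 - x.2.2.2 = 0 ∧
        x.1 ^ d - x.2.1 ^ d + x.2.2.1 ^ d - x.2.2.2 ^ d = 0) := by
    ext x
    simp
  have hcol := card_pairSum_collisions hq3 hq hd h5sq
  rw [sum_mixedWeight hq3 h5, ← hlam] at hcol
  rw [hset, Set.ncard_coe_finset, card_quadruples hq3 hq hd]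
  linear_combination ((Fintype.card F : ℤ) - 1) * hcol
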